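/- Let (σ_η², ν_η, γ_η) and (σ_Ũ², ν_Ũ, γ_Ũ) be Lévy triplets with ν_Ũ concentrated on [−1,∞), and let μ be any Borel probability measure on ℝ. Then lim_{t→∞} (1/ln t) [ ∫_{[1,t]} z^{−2} (σ_η²/2 + z² σ_Ũ²/2) μ(dz) + ∫₁ᵗ z^{−2} ( (S_η∗μ)(z) + r_μ(z) ) dz − ∫₁ᵗ z^{−2} ( D_μ(z) + ∫₀^z (B_η∗μ)(x) dx + ∫₀^z κ_μ(s) ds ) dz ] = 0. -/

import Mathlib

open MeasureTheory Set Filter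

noncomputable section

namespace KEF

def IsLevyMeasure (ν : Measure ℝ) : Prop :=
  ν {0} = 0 ∧ ∫⁻ y, ENNReal.ofReal (min 1 (y ^ 2)) ∂ν < ⊤

/-- The generator `A` of the killed generalized OU process, expressed through the
Lévy triplets `(ση2, νη, γη)` of `η` and `(σU2, νU, γU)` of `Ũ`. -/
def levyGen (ση2 γη σU2 γU : ℝ) (νη νU : Measure ℝ) (f : ℝ → ℝ) (x : ℝ) : ℝ :=
  γη * deriv f x + ση2 / 2 * deriv (deriv f) x
    + (∫ y, (f (x + y) - f x - (if |y| ≤ 1 then y * deriv f x else 0)) ∂νη)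
    + γU * (x * deriv f x) + σU2 / 2 * (x ^ 2 * deriv (deriv f) x)
    + ∫ y in Ici (-1 : ℝ), (f (x + x * y) - f x - (if |y| ≤ 1 then x * y * deriv f x else 0)) ∂νU

/-- `μ` is invariant for the generator: `∫ Af dμ = 0` for all test functions `f`. -/
def Invariant (ση2 γη σU2 γU : ℝ) (νη νU : Measure ℝ) (μ : Measure ℝ) : Prop :=
  ∀ f : ℝ → ℝ, ContDiff ℝ (⊤ : ℕ∞) f → HasCompactSupport f →
    ∫ x, levyGen ση2 γη σU2 γU νη νU f x ∂μ = 0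

def Bmap (ν : Measure ℝ) (z : ℝ) : ℝ :=
  if 0 < z then (ν (Ioi (max z 1))).toReal
  else if z < 0 then -((ν (Iio (min z (-1)))).toReal)
  else 0

def BUmap (ν : Measure ℝ) (z : ℝ) : ℝ :=
  if 1 < z then (ν (Ioi (max (z - 1) 1))).toReal else 0

def Smap (ν : Measure ℝ) (z : ℝ) : ℝ :=
  if 0 < z then ∫ y in Ici z ∩ Icc (-1 : ℝ) 1, (y - z) ∂ν
  else if z < 0 then ∫ y in Iic z ∩ Icc (-1 : ℝ) 1, (z - y) ∂ν
  else 0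

def SUmap (ν : Measure ℝ) (z : ℝ) : ℝ :=
  if 0 ≤ z ∧ z < 1 then ∫ y in Icc (-1 : ℝ) (z - 1), (z - 1 - y) ∂ν
  else if 1 < z then ∫ y in Ici (z - 1) ∩ Icc (-1 : ℝ) 1, (y - z + 1) ∂ν
  else 0

/-- convolution of a function with a measure -/
def convM (g : ℝ → ℝ) (μ : Measure ℝ) (z : ℝ) : ℝ := ∫ x, g (z - x) ∂μ

def rmu (νU : Measure ℝ) (μ : Measure ℝ) (z : ℝ) : ℝ :=
  if 0 < z then ∫ x in Ioi (0 : ℝ), x * SUmap νU (z / x) ∂μ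
  else if z < 0 then ∫ x in Iio (0 : ℝ), |x| * SUmap νU (z / x) ∂μ
  else 0

def kmu (νU : Measure ℝ) (μ : Measure ℝ) (t : ℝ) : ℝ :=
  if 0 < t then ∫ x in Ioc (0 : ℝ) t, BUmap νU (t / x) ∂μ
  else if t < 0 then -∫ x in Ico t (0 : ℝ), BUmap νU (t / x) ∂μ
  else 0

def Dmu (γη γU : ℝ) (μ : Measure ℝ) (z : ℝ) : ℝ :=
  if 0 ≤ z then ∫ x in Ioc (0 : ℝ) z, (γη + x * γU) ∂μ
  else -∫ x in Ioc z (0 : ℝ), (γη + x * γU) ∂μ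

end KEF

namespace KEF

section Asymptotics

/-- An interval integral is controlled by any majorant that splits into a globally integrable
part `P` and a locally integrable part `h`; no regularity of the integrand is needed. -/
lemma abs_intervalIntegral_le {f h : ℝ → ℝ} {P : ℝ → ENNReal} {a b : ℝ} (hab : a ≤ b)
    (hP : Measurable P) (hPfin : ∫⁻ z, P z ≠ ⊤) (hh : IntervalIntegrable h volume a b)
    (h0 : ∀ z ∈ Ioc a b, 0 ≤ h z)
    (hf : ∀ z ∈ Ioc a b, ‖f z‖ₑ ≤ P z + ENNReal.ofReal (h z)) :
    |∫ z in a..b, f z| ≤ (∫⁻ z, P z).toReal + ∫ z in a..b, h z := by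
  rw [intervalIntegral.integral_of_le hab, intervalIntegral.integral_of_le hab]
  have hint : 0 ≤ ∫ z in Ioc a b, h z := setIntegral_nonneg measurableSet_Ioc h0
  have key : ‖∫ z in Ioc a b, f z‖ₑ ≤ (∫⁻ z, P z) + ENNReal.ofReal (∫ z in Ioc a b, h z) :=
    calc ‖∫ z in Ioc a b, f z‖ₑ ≤ ∫⁻ z in Ioc a b, ‖f z‖ₑ := enorm_integral_le_lintegral_enorm _
      _ ≤ ∫⁻ z in Ioc a b, (P z + ENNReal.ofReal (h z)) :=
          setLIntegral_mono' measurableSet_Ioc hf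
      _ = (∫⁻ z in Ioc a b, P z) + ∫⁻ z in Ioc a b, ENNReal.ofReal (h z) :=
          lintegral_add_left hP _
      _ ≤ _ := by
          rw [ofReal_integral_eq_lintegral_ofReal]
          · gcongr
            exact Measure.restrict_le_self
          · exact (intervalIntegrable_iff_integrableOn_Ioc_of_le hab).1 hh
          · exact (ae_restrict_iff' measurableSet_Ioc).2 (Eventually.of_forall h0)
  have := ENNReal.toReal_mono (by simp [hPfin]) key
  rwa [toReal_enorm, ENNReal.toReal_add hPfin ENNReal.ofReal_ne_top,
    ENNReal.toReal_ofReal hint] at this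

lemma tendsto_log_average {f q : ℝ → ℝ} {P : ℝ → ENNReal} {M : ℝ}
    (hP : Measurable P) (hPfin : ∫⁻ z, P z ≠ ⊤)
    (hM : ∀ z, 1 < z → q z ≤ M) (hq : Tendsto q atTop (nhds 0))
    (hf : ∀ z, 1 < z → ‖f z‖ₑ ≤ P z + ENNReal.ofReal (q z / z)) :
    Tendsto (fun t => (1 / Real.log t) * ∫ z in (1 : ℝ)..t, f z) atTop (nhds 0) := by
  rw [Metric.tendsto_nhds]
  intro ε hε
  obtain ⟨T, hT⟩ := eventually_atTop.1 (hq.eventually_le_const (half_pos hε))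
  set P' : ℝ → ENNReal := fun z => P z + (Ioc 1 T).indicator (fun _ => ENNReal.ofReal |M|) z
    with hP'
  have hP'm : Measurable P' := hP.add (measurable_const.indicator measurableSet_Ioc)
  have hP'fin : ∫⁻ z, P' z ≠ ⊤ := by
    rw [hP', lintegral_add_left hP, lintegral_indicator measurableSet_Ioc]
    simp [hPfin, ENNReal.mul_eq_top]
  set K := (∫⁻ z, P' z).toReal
  have hlog : ∀ᶠ t in atTop, 2 * K / ε < Real.log t :=
    Real.tendsto_log_atTop.eventually_gt_atTop _
  filter_upwards [hlog, eventually_gt_atTop 1] with t ht ht1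
  have hl : 0 < Real.log t := Real.log_pos ht1
  have hcont : IntervalIntegrable (fun z : ℝ => ε / 2 * (1 / z)) volume 1 t := by
    apply (intervalIntegral.intervalIntegrable_one_div _ continuousOn_id).const_mul
    intro x hx
    rw [uIcc_of_le ht1.le] at hx
    exact (zero_lt_one.trans_le hx.1).ne'
  have hb := abs_intervalIntegral_le (f := f) (h := fun z => ε / 2 * (1 / z)) ht1.le hP'm hP'fin
    hcont
    (fun z hz => by have := zero_lt_one.trans hz.1; positivity)
    (fun z hz => by
      have hz0 := zero_lt_one.trans hz.1
      refine (hf z hz.1).trans ?_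
      rw [hP', add_assoc]
      gcongr
      by_cases hzT : z ≤ T
      · rw [indicator_of_mem (show z ∈ Ioc 1 T from ⟨hz.1, hzT⟩)]
        refine le_trans (ENNReal.ofReal_le_ofReal ?_) le_self_add
        rw [div_le_iff₀ hz0]
        have h1 := hM z hz.1
        nlinarith [le_abs_self M, abs_nonneg M, hz.1]
      · refine le_trans (ENNReal.ofReal_le_ofReal ?_) le_add_self
        rw [div_eq_mul_one_div]
        gcongr
        exact hT z (not_le.1 hzT).le)
  rw [intervalIntegral.integral_const_mul, integral_one_div_of_pos one_pos (by linarith),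
    div_one] at hb
  rw [Real.dist_eq, sub_zero, abs_mul, abs_of_pos (by positivity), one_div_mul_eq_div,
    div_lt_iff₀ hl]
  rw [div_lt_iff₀ hε] at ht
  change _ ≤ K + _ at hb
  linarith

lemma tendsto_average_zero {g : ℝ → ℝ} {M : ℝ}
    (hM : ∀ s, 0 < s → |g s| ≤ M) (hg : Tendsto g atTop (nhds 0)) :
    Tendsto (fun z => (∫ s in (0 : ℝ)..z, g s) / z) atTop (nhds 0) := by
  rw [Metric.tendsto_nhds]
  intro ε hε
  have hg' : Tendsto (fun s => |g s|) atTop (nhds 0) := by simpa using hg.abs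
  obtain ⟨T, hT⟩ := eventually_atTop.1 (hg'.eventually_le_const (half_pos hε))
  set P : ℝ → ENNReal := (Ioc 0 T).indicator (fun _ => ENNReal.ofReal M) with hP
  have hPm : Measurable P := measurable_const.indicator measurableSet_Ioc
  have hPfin : ∫⁻ z, P z ≠ ⊤ := by
    rw [hP, lintegral_indicator measurableSet_Ioc]
    simp [ENNReal.mul_eq_top]
  set K := (∫⁻ z, P z).toReal
  filter_upwards [eventually_gt_atTop (2 * K / ε), eventually_gt_atTop 0] with z hz hz0
  have hb := abs_intervalIntegral_le (f := g) (h := fun _ => ε / 2) hz0.le hPm hPfin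
    intervalIntegrable_const (fun _ _ => by positivity)
    (fun s hs => by
      rw [Real.enorm_eq_ofReal_abs]
      by_cases hsT : s ≤ T
      · rw [hP, indicator_of_mem (show s ∈ Ioc 0 T from ⟨hs.1, hsT⟩)]
        exact le_trans (ENNReal.ofReal_le_ofReal (hM s hs.1)) le_self_add
      · exact le_trans (ENNReal.ofReal_le_ofReal (hT s (not_le.1 hsT).le)) le_add_self)
  rw [intervalIntegral.integral_const, smul_eq_mul, sub_zero] at hb
  rw [Real.dist_eq, sub_zero, abs_div, abs_of_pos hz0, div_lt_iff₀ hz0]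
  rw [div_lt_iff₀ hε] at hz
  change _ ≤ K + _ at hb
  linarith

lemma abs_average_le {g : ℝ → ℝ} {M z : ℝ} (hM : ∀ s, 0 < s → |g s| ≤ M) (hz : 0 < z) :
    |∫ s in (0 : ℝ)..z, g s| / z ≤ M := by
  rw [div_le_iff₀ hz]
  have := intervalIntegral.norm_integral_le_of_norm_le_const (f := g) (a := 0) (b := z) (C := M)
    (fun s hs => by rw [uIoc_of_le hz.le] at hs; exact hM s hs.1)
  simpa [abs_of_pos hz] using this

end Asymptotics

section LevyMeasure

variable {ν : Measure ℝ}

lemma IsLevyMeasure.sFinite (hν : IsLevyMeasure ν) : SFinite ν := by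
  have hm : Measurable fun y : ℝ => ENNReal.ofReal (min 1 (y ^ 2)) := by fun_prop
  have : IsFiniteMeasure (ν.withDensity fun y : ℝ => ENNReal.ofReal (min 1 (y ^ 2))) :=
    isFiniteMeasure_withDensity hν.2.ne
  have h0 : ∀ᵐ y ∂ν, ENNReal.ofReal (min 1 (y ^ 2)) ≠ 0 := by
    have : ∀ᵐ y ∂ν, y ≠ 0 := by
      rw [ae_iff]
      simpa using hν.1
    filter_upwards [this] with y hy
    simp only [ne_eq, ENNReal.ofReal_eq_zero, not_le]
    positivity
  rw [← withDensity_inv_same hm h0 (Eventually.of_forall fun _ => ENNReal.ofReal_ne_top)]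
  infer_instance

lemma IsLevyMeasure.measure_ne_top_of_le_abs (hν : IsLevyMeasure ν) {r : ℝ} (hr : 0 < r) {s : Set ℝ}
    (hs : ∀ y ∈ s, r ≤ |y|) : ν s ≠ ⊤ := by
  have hm : Measurable fun y : ℝ => ENNReal.ofReal (min 1 (y ^ 2)) := by fun_prop
  have hpos : ENNReal.ofReal (min 1 (r ^ 2)) ≠ 0 := by
    simp only [ne_eq, ENNReal.ofReal_eq_zero, not_le]
    positivity
  have hfin := meas_ge_le_lintegral_div (μ := ν) hm.aemeasurable hpos ENNReal.ofReal_ne_top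
  refine ne_top_of_le_ne_top (ENNReal.div_ne_top hν.2.ne hpos)
    ((measure_mono fun y hy => ?_).trans hfin)
  refine ENNReal.ofReal_le_ofReal (min_le_min_left _ ?_)
  rw [← sq_abs y]
  exact pow_le_pow_left₀ hr.le (hs y hy) 2

lemma tendsto_measure_zero_of_antitone {μ : Measure ℝ} {s : ℝ → Set ℝ} (hs : Antitone s)
    (hm : ∀ z, MeasurableSet (s z)) (hfin : ∃ z, μ (s z) ≠ ⊤) (hsub : ∀ z, s z ⊆ Ici z) :
    Tendsto (fun z => (μ (s z)).toReal) atTop (nhds 0) := by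
  have h := tendsto_measure_iInter_atTop (μ := μ) (fun z => (hm z).nullMeasurableSet) hs hfin
  have he : ⋂ z, s z = ∅ := by
    ext y
    simp only [mem_iInter, mem_empty_iff_false, iff_false, not_forall]
    exact ⟨y + 1, fun hy => by have := hsub _ hy; simp only [mem_Ici] at this; linarith⟩
  rw [he, measure_empty] at h
  exact (ENNReal.tendsto_toReal ENNReal.zero_ne_top).comp h

lemma IsLevyMeasure.tendsto_tail (hν : IsLevyMeasure ν) :
    Tendsto (fun z : ℝ => (ν (Ioi (max z 1))).toReal) atTop (nhds 0) := by
  refine tendsto_measure_zero_of_antitone (fun a b hab => Ioi_subset_Ioi (max_le_max_right _ hab))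
    (fun _ => measurableSet_Ioi) ⟨1, hν.measure_ne_top_of_le_abs one_pos ?_⟩ ?_
  · intro y hy
    simp only [max_self, mem_Ioi] at hy
    exact hy.le.trans (le_abs_self y)
  · intro z y hy
    exact (le_max_left _ _).trans (mem_Ioi.1 hy).le

lemma IsLevyMeasure.tail_le (hν : IsLevyMeasure ν) (z : ℝ) :
    (ν (Ioi (max z 1))).toReal ≤ (ν (Ioi 1)).toReal :=
  ENNReal.toReal_mono (hν.measure_ne_top_of_le_abs one_pos fun y hy => hy.le.trans (le_abs_self y))
    (measure_mono (Ioi_subset_Ioi (le_max_right _ _)))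

lemma IsLevyMeasure.tail_left_le (hν : IsLevyMeasure ν) (z : ℝ) :
    (ν (Iio (min z (-1)))).toReal ≤ (ν (Iio (-1))).toReal :=
  ENNReal.toReal_mono
    (hν.measure_ne_top_of_le_abs one_pos fun y hy => by
      simp only [mem_Iio] at hy
      linarith [neg_le_abs y])
    (measure_mono (Iio_subset_Iio (min_le_right _ _)))

lemma measurable_tail (ν : Measure ℝ) : Measurable fun z : ℝ => (ν (Ioi (max z 1))).toReal := by
  have : Antitone fun z : ℝ => ν (Ioi (max z 1)) :=
    fun a b hab => measure_mono (Ioi_subset_Ioi (max_le_max_right _ hab))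
  exact this.measurable.ennreal_toReal

lemma measurable_tail_left (ν : Measure ℝ) :
    Measurable fun z : ℝ => (ν (Iio (min z (-1)))).toReal := by
  have : Monotone fun z : ℝ => ν (Iio (min z (-1))) :=
    fun a b hab => measure_mono (Iio_subset_Iio (min_le_min_right _ hab))
  exact this.measurable.ennreal_toReal

end LevyMeasure

section LargeJumps

variable {ν μ : Measure ℝ}

lemma measurable_Bmap (ν : Measure ℝ) : Measurable (Bmap ν) :=
  Measurable.ite measurableSet_Ioi (measurable_tail ν)
    (Measurable.ite measurableSet_Iio (measurable_tail_left ν).neg measurable_const)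

lemma measurable_BUmap (ν : Measure ℝ) : Measurable (BUmap ν) :=
  Measurable.ite measurableSet_Ioi ((measurable_tail ν).comp (measurable_id.sub_const 1))
    measurable_const

lemma IsLevyMeasure.abs_Bmap_le (hν : IsLevyMeasure ν) (z : ℝ) :
    |Bmap ν z| ≤ (ν (Ioi 1)).toReal + (ν (Iio (-1))).toReal := by
  have h1 := hν.tail_le z
  have h2 := hν.tail_left_le z
  have h3 : 0 ≤ (ν (Ioi (max z 1))).toReal := ENNReal.toReal_nonneg
  have h4 : 0 ≤ (ν (Iio (min z (-1)))).toReal := ENNReal.toReal_nonneg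
  unfold Bmap
  split_ifs
  · rw [abs_of_nonneg h3]; linarith
  · rw [abs_neg, abs_of_nonneg h4]; linarith
  · rw [abs_zero]; linarith

lemma IsLevyMeasure.abs_BUmap_le (hν : IsLevyMeasure ν) (z : ℝ) :
    |BUmap ν z| ≤ (ν (Ioi 1)).toReal := by
  have h1 := hν.tail_le (z - 1)
  have h3 : 0 ≤ (ν (Ioi (max (z - 1) 1))).toReal := ENNReal.toReal_nonneg
  unfold BUmap
  split_ifs
  · rwa [abs_of_nonneg h3]
  · rw [abs_zero]; linarith

lemma IsLevyMeasure.tendsto_Bmap (hν : IsLevyMeasure ν) : Tendsto (Bmap ν) atTop (nhds 0) := by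
  refine hν.tendsto_tail.congr' ?_
  filter_upwards [eventually_gt_atTop 0] with z hz
  rw [Bmap, if_pos hz]

lemma IsLevyMeasure.tendsto_BUmap (hν : IsLevyMeasure ν) : Tendsto (BUmap ν) atTop (nhds 0) := by
  refine (hν.tendsto_tail.comp (tendsto_atTop_add_const_right _ (-1) tendsto_id)).congr' ?_
  filter_upwards [eventually_gt_atTop 1] with z hz
  rw [BUmap, if_pos hz]
  rfl

lemma IsLevyMeasure.abs_convM_Bmap_le [IsProbabilityMeasure μ] (hν : IsLevyMeasure ν) (z : ℝ) :
    |convM (Bmap ν) μ z| ≤ (ν (Ioi 1)).toReal + (ν (Iio (-1))).toReal := by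
  simpa [convM] using norm_integral_le_of_norm_le_const (μ := μ) (f := fun x => Bmap ν (z - x))
    (Eventually.of_forall fun x => hν.abs_Bmap_le (z - x))

lemma IsLevyMeasure.tendsto_convM_Bmap [IsProbabilityMeasure μ] (hν : IsLevyMeasure ν) :
    Tendsto (convM (Bmap ν) μ) atTop (nhds 0) := by
  have := tendsto_integral_filter_of_dominated_convergence (μ := μ) (l := atTop)
    (F := fun z x => Bmap ν (z - x)) (f := fun _ => 0) (fun _ => _)
    (Eventually.of_forall fun z =>
      ((measurable_Bmap ν).comp (measurable_const.sub measurable_id)).aestronglyMeasurable)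
    (Eventually.of_forall fun z => Eventually.of_forall fun x => hν.abs_Bmap_le (z - x))
    (integrable_const _)
    (Eventually.of_forall fun x =>
      hν.tendsto_Bmap.comp (tendsto_atTop_add_const_right _ (-x) tendsto_id))
  rwa [integral_zero] at this

lemma kmu_eq_integral_indicator {t : ℝ} (ht : 0 < t) :
    kmu ν μ t = ∫ x, (Ioc 0 t).indicator (fun x => BUmap ν (t / x)) x ∂μ := by
  rw [kmu, if_pos ht, integral_indicator measurableSet_Ioc]

lemma IsLevyMeasure.abs_indicator_BUmap_le (hν : IsLevyMeasure ν) (t x : ℝ) :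
    ‖(Ioc 0 t).indicator (fun x => BUmap ν (t / x)) x‖ ≤ (ν (Ioi 1)).toReal :=
  (norm_indicator_le_norm_self _ _).trans (hν.abs_BUmap_le _)

lemma IsLevyMeasure.abs_kmu_le [IsProbabilityMeasure μ] (hν : IsLevyMeasure ν) {t : ℝ}
    (ht : 0 < t) : |kmu ν μ t| ≤ (ν (Ioi 1)).toReal := by
  rw [kmu_eq_integral_indicator ht]
  simpa using norm_integral_le_of_norm_le_const (μ := μ)
    (Eventually.of_forall fun x => hν.abs_indicator_BUmap_le t x)

lemma IsLevyMeasure.tendsto_kmu [IsProbabilityMeasure μ] (hν : IsLevyMeasure ν) :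
    Tendsto (kmu ν μ) atTop (nhds 0) := by
  have := tendsto_integral_filter_of_dominated_convergence (μ := μ) (l := atTop)
    (F := fun t x => (Ioc 0 t).indicator (fun x => BUmap ν (t / x)) x) (f := fun _ => 0)
    (fun _ => _)
    (Eventually.of_forall fun t =>
      (((measurable_BUmap ν).comp (measurable_const.div measurable_id)).indicator
        measurableSet_Ioc).aestronglyMeasurable)
    (Eventually.of_forall fun t => Eventually.of_forall fun x => hν.abs_indicator_BUmap_le t x)
    (integrable_const _)
    (Eventually.of_forall fun x => by
      by_cases hx : 0 < x
      · refine squeeze_zero_norm (fun t => norm_indicator_le_norm_self _ _) ?_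
        simpa using (hν.tendsto_BUmap.comp (tendsto_id.atTop_div_const hx)).norm
      · exact tendsto_const_nhds.congr fun t =>
          (indicator_of_notMem (fun h => hx h.1) _).symm)
  rw [integral_zero] at this
  refine this.congr' ?_
  filter_upwards [eventually_gt_atTop 0] with t ht
  rw [kmu_eq_integral_indicator ht]

end LargeJumps

section Drift

variable {μ : Measure ℝ}

lemma Dmu_div_eq (a b : ℝ) {z : ℝ} (hz : 0 < z) :
    Dmu a b μ z / z = ∫ x, (Ioc 0 z).indicator (fun x => (a + x * b) / z) x ∂μ := by
  rw [Dmu, if_pos hz.le, integral_indicator measurableSet_Ioc, integral_div]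

lemma norm_indicator_drift_le (a b : ℝ) {z : ℝ} (hz : 1 ≤ z) (x : ℝ) :
    ‖(Ioc 0 z).indicator (fun x => (a + x * b) / z) x‖ ≤ |a| + |b| := by
  have hz0 : 0 < z := one_pos.trans_le hz
  by_cases hx : x ∈ Ioc 0 z
  · rw [indicator_of_mem hx, Real.norm_eq_abs, abs_div, abs_of_pos hz0, div_le_iff₀ hz0]
    calc |a + x * b| ≤ |a| + |x * b| := abs_add_le _ _
      _ = |a| * 1 + x * |b| := by rw [abs_mul, abs_of_pos hx.1, mul_one]
      _ ≤ |a| * z + z * |b| := by gcongr; exact hx.2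
      _ = _ := by ring
  · rw [indicator_of_notMem hx, norm_zero]
    positivity

lemma abs_Dmu_div_le [IsProbabilityMeasure μ] (a b : ℝ) {z : ℝ} (hz : 1 ≤ z) :
    |Dmu a b μ z / z| ≤ |a| + |b| := by
  rw [Dmu_div_eq a b (one_pos.trans_le hz)]
  simpa using norm_integral_le_of_norm_le_const (μ := μ)
    (Eventually.of_forall fun x => norm_indicator_drift_le a b hz x)

lemma tendsto_Dmu_div [IsProbabilityMeasure μ] (a b : ℝ) :
    Tendsto (fun z => Dmu a b μ z / z) atTop (nhds 0) := by
  have := tendsto_integral_filter_of_dominated_convergence (μ := μ) (l := atTop)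
    (F := fun z x => (Ioc 0 z).indicator (fun x => (a + x * b) / z) x) (f := fun _ => 0)
    (fun _ => _)
    (Eventually.of_forall fun t =>
      (Measurable.indicator (by fun_prop) measurableSet_Ioc).aestronglyMeasurable)
    ((eventually_ge_atTop 1).mono fun z hz =>
      Eventually.of_forall fun x => norm_indicator_drift_le a b hz x)
    (integrable_const _)
    (Eventually.of_forall fun x => by
      refine squeeze_zero_norm (fun t => norm_indicator_le_norm_self _ _) ?_
      simpa using (tendsto_const_nhds.div_atTop tendsto_id :
        Tendsto (fun z : ℝ => (a + x * b) / z) atTop (nhds 0)).norm)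
  rw [integral_zero] at this
  refine this.congr' ?_
  filter_upwards [eventually_gt_atTop 0] with z hz
  rw [Dmu_div_eq a b hz]

end Drift

lemma norm_gaussian_part_le {μ : Measure ℝ} [IsProbabilityMeasure μ] {a b : ℝ} (ha : 0 ≤ a)
    (hb : 0 ≤ b) (t : ℝ) :
    ‖∫ z in Icc (1 : ℝ) t, (a / 2 + z ^ 2 * b / 2) / z ^ 2 ∂μ‖ ≤ a / 2 + b / 2 := by
  refine (norm_setIntegral_le_of_norm_le_const (C := a / 2 + b / 2) (measure_lt_top _ _)
    fun z hz => ?_).trans (mul_le_of_le_one_right (by positivity) measureReal_le_one)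
  have hz0 : 0 < z := one_pos.trans_le hz.1
  rw [Real.norm_eq_abs, abs_of_nonneg (by positivity), div_le_iff₀ (by positivity)]
  nlinarith [one_le_pow₀ hz.1 (n := 2)]

section SmallJumps

variable {ν μ : Measure ℝ}

/-- A kernel dominating the integrands of `Smap` and (after a shift by `1`) of `SUmap`. -/
def jumpKernel (z y : ℝ) : ENNReal :=
  if |y| ≤ 1 ∧ |z| ≤ |y| then ENNReal.ofReal |y| else 0

/-- The common majorant of `Smap` and of the shifted `SUmap`. -/
def jumpMajorant (ν : Measure ℝ) (z : ℝ) : ENNReal := ∫⁻ y, jumpKernel z y ∂ν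

lemma measurable_jumpKernel : Measurable (Function.uncurry jumpKernel) := by
  have h1 : Measurable fun p : ℝ × ℝ => |p.1| := by fun_prop
  have h2 : Measurable fun p : ℝ × ℝ => |p.2| := by fun_prop
  exact Measurable.ite ((measurableSet_le h2 measurable_const).inter (measurableSet_le h1 h2))
    h2.ennreal_ofReal measurable_const

lemma measurable_jumpMajorant [SFinite ν] : Measurable (jumpMajorant ν) :=
  measurable_jumpKernel.lintegral_prod_right'

lemma lintegral_jumpKernel_le (y : ℝ) :
    ∫⁻ z, jumpKernel z y ≤ 2 * ENNReal.ofReal (min 1 (y ^ 2)) := by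
  by_cases hy : |y| ≤ 1
  · have : ∀ z, jumpKernel z y = (Icc (-|y|) |y|).indicator (fun _ => ENNReal.ofReal |y|) z := by
      intro z
      simp only [jumpKernel, indicator, mem_Icc, ← abs_le, hy, true_and]
    simp_rw [this]
    rw [lintegral_indicator measurableSet_Icc, setLIntegral_const, Real.volume_Icc,
      ← ENNReal.ofReal_mul (abs_nonneg y), ← ENNReal.ofReal_ofNat 2,
      ← ENNReal.ofReal_mul zero_le_two]
    refine ENNReal.ofReal_le_ofReal ?_
    have hy2 : y ^ 2 ≤ 1 := by rw [← sq_abs]; exact pow_le_one₀ (abs_nonneg y) hy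
    rw [min_eq_right hy2, ← sq_abs y]
    linarith
  · simp [jumpKernel, hy]

lemma IsLevyMeasure.lintegral_jumpMajorant_ne_top (hν : IsLevyMeasure ν) :
    ∫⁻ z, jumpMajorant ν z ≠ ⊤ := by
  have := hν.sFinite
  unfold jumpMajorant
  rw [lintegral_lintegral_swap measurable_jumpKernel.aemeasurable]
  refine ne_top_of_le_ne_top ?_ (lintegral_mono lintegral_jumpKernel_le)
  rw [lintegral_const_mul' _ _ (by simp)]
  exact ENNReal.mul_ne_top (by simp) hν.2.ne

lemma enorm_setIntegral_le_jumpMajorant {s : Set ℝ} (hs : MeasurableSet s) {g : ℝ → ℝ} {z : ℝ}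
    (hg : ∀ y ∈ s, |y| ≤ 1 ∧ |z| ≤ |y| ∧ |g y| ≤ |y|) :
    ‖∫ y in s, g y ∂ν‖ₑ ≤ jumpMajorant ν z := by
  refine (enorm_integral_le_lintegral_enorm _).trans
    ((setLIntegral_mono' hs fun y hy => ?_).trans (setLIntegral_le_lintegral s _))
  obtain ⟨h1, h2, h3⟩ := hg y hy
  rw [jumpKernel, if_pos ⟨h1, h2⟩, Real.enorm_eq_ofReal_abs]
  exact ENNReal.ofReal_le_ofReal h3

lemma enorm_Smap_le (z : ℝ) : ‖Smap ν z‖ₑ ≤ jumpMajorant ν z := by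
  unfold Smap
  split_ifs with h1 h2
  · refine enorm_setIntegral_le_jumpMajorant (measurableSet_Ici.inter measurableSet_Icc) ?_
    rintro y ⟨hy, hy1⟩
    simp only [mem_Ici] at hy
    have hy0 : 0 < y := h1.trans_le hy
    rw [abs_of_pos hy0, abs_of_pos h1, abs_of_nonneg (by linarith)]
    exact ⟨hy1.2, hy, by linarith⟩
  · refine enorm_setIntegral_le_jumpMajorant (measurableSet_Iic.inter measurableSet_Icc) ?_
    rintro y ⟨hy, hy1⟩
    simp only [mem_Iic] at hy
    have hy0 : y < 0 := hy.trans_lt h2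
    rw [abs_of_neg hy0, abs_of_neg h2, abs_of_nonneg (by linarith)]
    exact ⟨by linarith [hy1.1], by linarith, by linarith⟩
  · simp

lemma enorm_SUmap_le (w : ℝ) : ‖SUmap ν w‖ₑ ≤ jumpMajorant ν (w - 1) := by
  unfold SUmap
  split_ifs with h1 h2
  · refine enorm_setIntegral_le_jumpMajorant measurableSet_Icc ?_
    rintro y ⟨hy, hy1⟩
    have hw : w - 1 < 0 := by linarith [h1.2]
    have hy0 : y < 0 := by linarith
    rw [abs_of_neg hy0, abs_of_neg hw, abs_of_nonneg (by linarith)]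
    exact ⟨by linarith, by linarith, by linarith⟩
  · refine enorm_setIntegral_le_jumpMajorant (measurableSet_Ici.inter measurableSet_Icc) ?_
    rintro y ⟨hy, hy1⟩
    simp only [mem_Ici] at hy
    have hw : 0 < w - 1 := by linarith
    have hy0 : 0 < y := by linarith
    rw [abs_of_pos hy0, abs_of_pos hw, abs_of_nonneg (by linarith)]
    exact ⟨hy1.2, hy, by linarith⟩
  · simp

lemma IsLevyMeasure.abs_SUmap_le (hν : IsLevyMeasure ν) {w : ℝ} (hw : 0 ≤ w) (hw' : w ≤ 1 / 2) :
    |SUmap ν w| ≤ (ν (Icc (-1) (-1 / 2))).toReal * w := by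
  have hfin : ν (Icc (-1) (-1 / 2)) ≠ ⊤ :=
    hν.measure_ne_top_of_le_abs (r := 1 / 2) (by norm_num) fun y hy => by
      linarith [hy.2, neg_le_abs y]
  have hsub : Icc (-1) (w - 1) ⊆ Icc (-1 : ℝ) (-1 / 2) := Icc_subset_Icc_right (by linarith)
  have hmono := measure_mono (μ := ν) hsub
  rw [SUmap, if_pos ⟨hw, by linarith⟩]
  have := norm_setIntegral_le_of_norm_le_const (μ := ν) (s := Icc (-1) (w - 1))
    (f := fun y => w - 1 - y) (C := w) (lt_of_le_of_lt hmono hfin.lt_top)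
    (fun y hy => by
      rw [Real.norm_eq_abs, abs_of_nonneg (by linarith [hy.2])]
      linarith [hy.1])
  rw [Real.norm_eq_abs, mul_comm] at this
  exact this.trans (mul_le_mul_of_nonneg_right (ENNReal.toReal_mono hfin hmono) hw)

/-- Majorant of `convM (Smap ν) μ`. -/
def convMajorant (ν μ : Measure ℝ) (z : ℝ) : ENNReal := ∫⁻ x, jumpMajorant ν (z - x) ∂μ

lemma measurable_convMajorant [SFinite ν] [SFinite μ] : Measurable (convMajorant ν μ) :=
  (measurable_jumpMajorant.comp (measurable_fst.sub measurable_snd)).lintegral_prod_right'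

lemma IsLevyMeasure.lintegral_convMajorant_ne_top [IsProbabilityMeasure μ]
    (hν : IsLevyMeasure ν) : ∫⁻ z, convMajorant ν μ z ≠ ⊤ := by
  have := hν.sFinite
  unfold convMajorant
  have hm : Measurable (Function.uncurry fun z x : ℝ => jumpMajorant ν (z - x)) :=
    measurable_jumpMajorant.comp (measurable_fst.sub measurable_snd)
  rw [lintegral_lintegral_swap hm.aemeasurable]
  simp_rw [lintegral_sub_right_eq_self (jumpMajorant ν)]
  simpa using hν.lintegral_jumpMajorant_ne_top

lemma enorm_convM_Smap_le (z : ℝ) : ‖convM (Smap ν) μ z‖ₑ ≤ convMajorant ν μ z :=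
  (enorm_integral_le_lintegral_enorm _).trans (lintegral_mono fun _ => enorm_Smap_le _)

/-- Majorant of the part of `rmu ν μ z / z ^ 2` that comes from `x < 2 * z`. -/
def scaleMajorant (ν μ : Measure ℝ) (z : ℝ) : ENNReal :=
  ∫⁻ x in Ioi (0 : ℝ), 4 * (ENNReal.ofReal |x⁻¹| * jumpMajorant ν (x⁻¹ * z - 1)) ∂μ

lemma measurable_scaleIntegrand [SFinite ν] : Measurable fun p : ℝ × ℝ =>
    4 * (ENNReal.ofReal |p.2⁻¹| * jumpMajorant ν (p.2⁻¹ * p.1 - 1)) := by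
  have h : Measurable fun p : ℝ × ℝ => jumpMajorant ν (p.2⁻¹ * p.1 - 1) :=
    measurable_jumpMajorant.comp (by fun_prop)
  have h' : Measurable fun p : ℝ × ℝ => ENNReal.ofReal |p.2⁻¹| := by fun_prop
  exact (h'.mul h).const_mul 4

lemma measurable_scaleMajorant [SFinite ν] [SFinite μ] : Measurable (scaleMajorant ν μ) :=
  measurable_scaleIntegrand.lintegral_prod_right'

lemma lintegral_comp_mul_left_sub_one [SFinite ν] {a : ℝ} (ha : a ≠ 0) :
    ENNReal.ofReal |a| * ∫⁻ z, jumpMajorant ν (a * z - 1) = ∫⁻ w, jumpMajorant ν w := by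
  have hm : Measurable fun w => jumpMajorant ν (w - 1) :=
    measurable_jumpMajorant.comp (by fun_prop)
  rw [← lintegral_sub_right_eq_self (jumpMajorant ν) 1]
  conv_rhs => rw [← Real.smul_map_volume_mul_left ha]
  rw [lintegral_smul_measure, lintegral_map hm (measurable_const_mul a), smul_eq_mul]

lemma IsLevyMeasure.lintegral_scaleMajorant_ne_top [IsProbabilityMeasure μ]
    (hν : IsLevyMeasure ν) : ∫⁻ z, scaleMajorant ν μ z ≠ ⊤ := by
  have := hν.sFinite
  unfold scaleMajorant
  rw [lintegral_lintegral_swap measurable_scaleIntegrand.aemeasurable]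
  have hbound : ∀ x ∈ Ioi (0 : ℝ),
      ∫⁻ z, 4 * (ENNReal.ofReal |x⁻¹| * jumpMajorant ν (x⁻¹ * z - 1))
        = 4 * ∫⁻ w, jumpMajorant ν w := by
    intro x hx
    rw [lintegral_const_mul' _ _ (by simp), lintegral_const_mul' _ _ ENNReal.ofReal_ne_top,
      lintegral_comp_mul_left_sub_one (inv_ne_zero (ne_of_gt hx))]
  rw [setLIntegral_congr_fun measurableSet_Ioi hbound, setLIntegral_const]
  exact ENNReal.mul_ne_top (ENNReal.mul_ne_top (by simp) hν.lintegral_jumpMajorant_ne_top)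
    (measure_ne_top _ _)

lemma IsLevyMeasure.enorm_scaled_SUmap_le (hν : IsLevyMeasure ν) {x z : ℝ} (hx : 0 < x)
    (hz : 0 < z) :
    ‖x * SUmap ν (z / x) / z ^ 2‖ₑ ≤
      4 * (ENNReal.ofReal |x⁻¹| * jumpMajorant ν (x⁻¹ * z - 1))
        + (Ici (2 * z)).indicator
          (fun _ => ENNReal.ofReal ((ν (Icc (-1) (-1 / 2))).toReal / z)) x := by
  by_cases h : 2 * z ≤ x
  · rw [indicator_of_mem (show x ∈ Ici (2 * z) from h), Real.enorm_eq_ofReal_abs]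
    refine le_trans (ENNReal.ofReal_le_ofReal ?_) le_add_self
    have hs := hν.abs_SUmap_le (w := z / x) (by positivity)
      (by rw [div_le_iff₀ hx]; linarith)
    rw [abs_div, abs_mul, abs_of_pos hx, abs_of_pos (pow_pos hz 2)]
    calc x * |SUmap ν (z / x)| / z ^ 2
        ≤ x * ((ν (Icc (-1) (-1 / 2))).toReal * (z / x)) / z ^ 2 := by gcongr
      _ = _ := by field_simp
  · refine le_trans ?_ le_self_add
    have he : x * SUmap ν (z / x) / z ^ 2 = x / z ^ 2 * SUmap ν (z / x) := by ring
    rw [he, enorm_mul, ← mul_assoc, ← ENNReal.ofReal_ofNat 4, ← ENNReal.ofReal_mul (by norm_num)]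
    refine mul_le_mul' ?_ ?_
    · rw [Real.enorm_eq_ofReal_abs]
      refine ENNReal.ofReal_le_ofReal ?_
      rw [abs_of_pos (by positivity), abs_of_pos (by positivity), ← div_eq_mul_inv,
        div_le_div_iff₀ (by positivity) hx]
      nlinarith
    · rw [inv_mul_eq_div]
      exact enorm_SUmap_le _

lemma IsLevyMeasure.enorm_rmu_div_le [IsProbabilityMeasure μ] (hν : IsLevyMeasure ν) {z : ℝ}
    (hz : 0 < z) :
    ‖rmu ν μ z / z ^ 2‖ₑ ≤ scaleMajorant ν μ z
      + ENNReal.ofReal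
        ((ν (Icc (-1) (-1 / 2))).toReal * (μ (Ici (2 * z))).toReal / z) := by
  rw [rmu, if_pos hz, ← integral_div]
  refine (enorm_integral_le_lintegral_enorm _).trans
    ((setLIntegral_mono' measurableSet_Ioi fun x hx => hν.enorm_scaled_SUmap_le hx hz).trans ?_)
  rw [lintegral_add_right _ (measurable_const.indicator measurableSet_Ici)]
  refine add_le_add le_rfl ((setLIntegral_le_lintegral _ _).trans ?_)
  rw [lintegral_indicator measurableSet_Ici, setLIntegral_const, mul_div_right_comm,
    ENNReal.ofReal_mul (by positivity), ENNReal.ofReal_toReal (measure_ne_top _ _)]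

end SmallJumps

end KEF

open KEF



theorem stmt4 (ση2 γη σU2 γU : ℝ) (νη νU : Measure ℝ)
    (hση : 0 ≤ ση2) (hσU : 0 ≤ σU2)
    (hνη : IsLevyMeasure νη) (hνU : IsLevyMeasure νU)
    (hconc : νU (Iio (-1 : ℝ)) = 0)
    (μ : Measure ℝ) [IsProbabilityMeasure μ] :
    Filter.Tendsto (fun t : ℝ =>
      (1 / Real.log t) *
        ((∫ z in Icc (1 : ℝ) t, (ση2 / 2 + z ^ 2 * σU2 / 2) / z ^ 2 ∂μ)
          + (∫ z in (1 : ℝ)..t, (convM (Smap νη) μ z + rmu νU μ z) / z ^ 2)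
          - ∫ z in (1 : ℝ)..t,
              (Dmu γη γU μ z + (∫ x in (0 : ℝ)..z, convM (Bmap νη) μ x)
                + ∫ s in (0 : ℝ)..z, kmu νU μ s) / z ^ 2))
      Filter.atTop (nhds 0) := by
  have hsη := hνη.sFinite
  have hsU := hνU.sFinite
  have hlog : Tendsto (fun t : ℝ => 1 / Real.log t) atTop (nhds 0) :=
    tendsto_const_nhds.div_atTop Real.tendsto_log_atTop
  have hgauss : Tendsto (fun t : ℝ => (1 / Real.log t) *
      ∫ z in Icc (1 : ℝ) t, (ση2 / 2 + z ^ 2 * σU2 / 2) / z ^ 2 ∂μ) atTop (nhds 0) :=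
    hlog.zero_mul_isBoundedUnder_le (isBoundedUnder_of ⟨_, norm_gaussian_part_le hση hσU⟩)
  have hsmall : Tendsto (fun t : ℝ => (1 / Real.log t) *
      ∫ z in (1 : ℝ)..t, (convM (Smap νη) μ z + rmu νU μ z) / z ^ 2) atTop (nhds 0) := by
    set C := (νU (Icc (-1) (-1 / 2))).toReal
    refine tendsto_log_average (P := fun z => convMajorant νη μ z + scaleMajorant νU μ z)
      (q := fun z => C * (μ (Ici (2 * z))).toReal) (M := C)
      (measurable_convMajorant.add measurable_scaleMajorant) ?_ ?_ ?_ ?_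
    · rw [lintegral_add_left measurable_convMajorant]
      exact ENNReal.add_ne_top.2
        ⟨hνη.lintegral_convMajorant_ne_top, hνU.lintegral_scaleMajorant_ne_top⟩
    · intro z _
      exact mul_le_of_le_one_right ENNReal.toReal_nonneg measureReal_le_one
    · have := tendsto_measure_zero_of_antitone (μ := μ) (s := Ici)
        (fun a b hab => Ici_subset_Ici.2 hab) (fun _ => measurableSet_Ici)
        ⟨0, measure_ne_top _ _⟩ (fun z => subset_rfl)
      simpa using (this.comp (tendsto_id.const_mul_atTop two_pos)).const_mul C
    · intro z hz
      have hz0 : 0 < z := one_pos.trans hz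
      rw [add_div, add_assoc]
      refine (enorm_add_le _ _).trans (add_le_add ?_ (hνU.enorm_rmu_div_le hz0))
      refine le_trans ?_ (enorm_convM_Smap_le z)
      rw [Real.enorm_eq_ofReal_abs, Real.enorm_eq_ofReal_abs, abs_div,
        abs_of_pos (pow_pos hz0 2)]
      exact ENNReal.ofReal_le_ofReal (div_le_self (abs_nonneg _) (one_le_pow₀ hz.le))
  have hdrift : Tendsto (fun t : ℝ => (1 / Real.log t) * ∫ z in (1 : ℝ)..t,
      (Dmu γη γU μ z + (∫ x in (0 : ℝ)..z, convM (Bmap νη) μ x)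
        + ∫ s in (0 : ℝ)..z, kmu νU μ s) / z ^ 2) atTop (nhds 0) := by
    refine tendsto_log_average (P := fun _ => 0)
      (q := fun z => |Dmu γη γU μ z / z| + |(∫ x in (0 : ℝ)..z, convM (Bmap νη) μ x) / z|
        + |(∫ s in (0 : ℝ)..z, kmu νU μ s) / z|)
      (M := (|γη| + |γU|) + ((νη (Ioi 1)).toReal + (νη (Iio (-1))).toReal)
        + (νU (Ioi 1)).toReal)
      measurable_const (by simp) ?_ ?_ ?_
    · intro z hz
      have hz0 : 0 < z := one_pos.trans hz
      refine add_le_add (add_le_add (abs_Dmu_div_le _ _ hz.le) ?_) ?_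
      · rw [abs_div, abs_of_pos hz0]
        exact abs_average_le (fun s _ => hνη.abs_convM_Bmap_le s) hz0
      · rw [abs_div, abs_of_pos hz0]
        exact abs_average_le (fun s hs => hνU.abs_kmu_le hs) hz0
    · have h1 := tendsto_average_zero (fun s _ => hνη.abs_convM_Bmap_le (μ := μ) s)
        hνη.tendsto_convM_Bmap
      have h2 := tendsto_average_zero (fun s hs => hνU.abs_kmu_le (μ := μ) hs) hνU.tendsto_kmu
      simpa using ((tendsto_Dmu_div (μ := μ) γη γU).abs.add h1.abs).add h2.abs
    · intro z hz
      have hz0 : 0 < z := one_pos.trans hz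
      rw [zero_add, Real.enorm_eq_ofReal_abs]
      refine ENNReal.ofReal_le_ofReal ?_
      rw [pow_two, ← div_div, abs_div, abs_of_pos hz0]
      refine div_le_div_of_nonneg_right ?_ hz0.le
      rw [add_div, add_div]
      exact abs_add_three _ _ _
  simpa [mul_sub, mul_add] using (hgauss.add hsmall).sub hdrift

end
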